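/- For α > 1 and x > 0, define W(x) := ∫₁^∞ (u-1)^{1/α} / (u(u+x)) du. Then W(x) = π((x+1)^{1/α} - 1) / (x sin(π/α)). -/

import Mathlib

open Real MeasureTheory

lemma lintegral_rpow_mul_exp_neg_mul_Ioi {a r : ℝ} (ha : 0 < a) (hr : 0 < r) :
    ∫⁻ t in Set.Ioi (0:ℝ), ENNReal.ofReal (t ^ (a - 1) * exp (-(r * t))) =
      ENNReal.ofReal ((1 / r) ^ a * Gamma a) := by
  have h := integral_rpow_mul_exp_neg_mul_Ioi ha hr
  have hpos : 0 < (1 / r) ^ a * Gamma a := mul_pos (by positivity) (Gamma_pos_of_pos ha)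
  rw [← h, ofReal_integral_eq_lintegral_ofReal]
  · exact .of_integral_ne_zero (h ▸ hpos.ne')
  · filter_upwards [ae_restrict_mem measurableSet_Ioi] with t (ht : 0 < t)
    simp only [Pi.zero_apply]
    positivity

lemma lintegral_rpow_div_add_Ioi {s b : ℝ} (hs : 0 < s) (hs' : s < 1) (hb : 0 < b) :
    ∫⁻ t in Set.Ioi (0:ℝ), ENNReal.ofReal (t ^ (s - 1) / (t + b)) =
      ENNReal.ofReal (b ^ (s - 1) * (π / sin (π * s))) := by
  have hΓ := Gamma_pos_of_pos hs
  calc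
    _ = ∫⁻ t in Set.Ioi (0:ℝ), ∫⁻ y in Set.Ioi (0:ℝ),
        ENNReal.ofReal (t ^ (s - 1) * exp (-((t + b) * y))) := by
      refine setLIntegral_congr_fun measurableSet_Ioi fun t (ht : 0 < t) => ?_
      have h := lintegral_rpow_mul_exp_neg_mul_Ioi one_pos (add_pos ht hb)
      simp only [sub_self, rpow_zero, one_mul, rpow_one, Gamma_one, mul_one] at h
      have ht' : 0 ≤ t ^ (s - 1) := by positivity
      simp_rw [ENNReal.ofReal_mul ht']
      rw [lintegral_const_mul _ (by fun_prop), h, ← ENNReal.ofReal_mul ht', mul_one_div]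
    _ = ∫⁻ y in Set.Ioi (0:ℝ), ∫⁻ t in Set.Ioi (0:ℝ),
        ENNReal.ofReal (t ^ (s - 1) * exp (-((t + b) * y))) :=
      lintegral_lintegral_swap (by unfold Function.uncurry; fun_prop)
    _ = ∫⁻ y in Set.Ioi (0:ℝ),
        ENNReal.ofReal (Gamma s) * ENNReal.ofReal (y ^ (1 - s - 1) * exp (-(b * y))) := by
      refine setLIntegral_congr_fun measurableSet_Ioi fun y (hy : 0 < y) => ?_
      have h (t : ℝ) : t ^ (s - 1) * exp (-((t + b) * y)) =
          exp (-(b * y)) * (t ^ (s - 1) * exp (-(y * t))) := by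
        rw [mul_left_comm, ← exp_add]
        ring_nf
      simp_rw [h, ENNReal.ofReal_mul (exp_pos (-(b * y))).le]
      rw [lintegral_const_mul _ (by fun_prop), lintegral_rpow_mul_exp_neg_mul_Ioi hs hy,
        ← ENNReal.ofReal_mul (exp_pos _).le, ← ENNReal.ofReal_mul hΓ.le, one_div,
        inv_rpow hy.le, ← rpow_neg hy.le]
      ring_nf
    _ = _ := by
      rw [lintegral_const_mul _ (by fun_prop),
        lintegral_rpow_mul_exp_neg_mul_Ioi (sub_pos.2 hs') hb, ← ENNReal.ofReal_mul hΓ.le,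
        ← Gamma_mul_Gamma_one_sub, one_div, inv_rpow hb.le, ← rpow_neg hb.le]
      ring_nf

lemma integral_rpow_div_add_Ioi {s b : ℝ} (hs : 0 < s) (hs' : s < 1) (hb : 0 < b) :
    ∫ t in Set.Ioi (0:ℝ), t ^ (s - 1) / (t + b) = b ^ (s - 1) * (π / sin (π * s)) := by
  rw [integral_eq_lintegral_of_nonneg_ae _ (by fun_prop : Measurable _).aestronglyMeasurable,
    lintegral_rpow_div_add_Ioi hs hs' hb, ENNReal.toReal_ofReal]
  · rw [← Gamma_mul_Gamma_one_sub]
    have := Gamma_pos_of_pos hs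
    have := Gamma_pos_of_pos (sub_pos.2 hs')
    positivity
  · filter_upwards [ae_restrict_mem measurableSet_Ioi] with t (ht : 0 < t)
    simp only [Pi.zero_apply]
    positivity

lemma integrableOn_rpow_div_add_Ioi {s b : ℝ} (hs : 0 < s) (hs' : s < 1) (hb : 0 < b) :
    IntegrableOn (fun t : ℝ => t ^ (s - 1) / (t + b)) (Set.Ioi 0) := by
  refine .of_integral_ne_zero ?_
  rw [integral_rpow_div_add_Ioi hs hs' hb, ← Gamma_mul_Gamma_one_sub]
  have := Gamma_pos_of_pos hs
  have := Gamma_pos_of_pos (sub_pos.2 hs')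
  positivity

theorem W_closed_form (α x : ℝ) (hα : 1 < α) (hx : 0 < x) :
    ∫ u in Set.Ioi (1:ℝ), (u - 1) ^ (1/α) / (u * (u + x)) =
      π * ((x + 1) ^ (1/α) - 1) / (x * Real.sin (π / α)) := by
  have hs : 0 < 1 / α := by positivity
  have hs' : 1 / α < 1 := by rwa [div_lt_one (by positivity)]
  rw [div_eq_mul_one_div π α]
  generalize 1 / α = s at *
  have hx1 : 0 < x + 1 := by positivity
  have hshift := (measurePreserving_add_right volume (1:ℝ)).setIntegral_preimage_emb
    (measurableEmbedding_addRight 1) (fun u => (u - 1) ^ s / (u * (u + x))) (Set.Ioi 1)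
  rw [← hshift, Set.preimage_add_const_Ioi, sub_self]
  have hsplit : ∀ t ∈ Set.Ioi (0:ℝ), (t + 1 - 1) ^ s / ((t + 1) * (t + 1 + x)) =
      (x + 1) / x * (t ^ (s - 1) / (t + (x + 1))) - 1 / x * (t ^ (s - 1) / (t + 1)) := by
    intro t (ht : 0 < t)
    rw [add_sub_cancel_right, rpow_sub_one ht.ne']
    have : t + 1 + x ≠ 0 := by positivity
    have : t + (x + 1) ≠ 0 := by positivity
    field_simp
    ring
  rw [setIntegral_congr_fun measurableSet_Ioi hsplit,
    integral_sub ((integrableOn_rpow_div_add_Ioi hs hs' hx1).const_mul _)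
      ((integrableOn_rpow_div_add_Ioi hs hs' one_pos).const_mul _),
    integral_const_mul, integral_const_mul, integral_rpow_div_add_Ioi hs hs' hx1,
    integral_rpow_div_add_Ioi hs hs' one_pos, one_rpow, rpow_sub_one hx1.ne']
  have hsin : sin (π * s) ≠ 0 :=
    (sin_pos_of_pos_of_lt_pi (by positivity) (by nlinarith [pi_pos])).ne'
  field_simp
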